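/- arXiv:math/0311172 — 2 statements merged into one kernel-verified Lean document; each statement's English description precedes it below -/
import Mathlib

section
/- Let m ≥ 1, let E = EuclideanSpace ℝ (Fin m), let c ∈ E and r > 0, and let F, G : E → E be maps which are continuous on the closed ball B̄(c, r) with F injective on B̄(c, r). Suppose that for every x on the sphere S(c, r) = {x : ‖x - c‖ = r} one has ‖G x - F x‖ < ‖F x - F c‖. Then there exists a point x ∈ B̄(c, r) with G x = F c. -/
open MeasureTheory Metric Set Polynomial

theorem exists_polynomial_eval_eq_setIntegral {X : Type*} [TopologicalSpace X] [T2Space X]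
    [MeasurableSpace X] [BorelSpace X] (μ : Measure X) [IsFiniteMeasureOnCompacts μ]
    {K : Set X} (hK : IsCompact K) (p : C(K, ℝ)[X]) :
    ∃ q : ℝ[X], ∀ (t : ℝ) (u : X → ℝ),
      (∀ x : K, p.eval (algebraMap ℝ C(K, ℝ) t) x = u x) → q.eval t = ∫ x in K, u x ∂μ := by
  have : CompactSpace K := isCompact_iff_compactSpace.mp hK
  have : IsFiniteMeasure (μ.comap ((↑) : K → X)) := by
    constructor
    rw [Measure.comap_apply _ Subtype.val_injective
      (fun s hs ↦ hK.measurableSet.subtype_image hs) _ MeasurableSet.univ]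
    simpa using hK.measure_lt_top
  have hint (g : C(K, ℝ)) : Integrable g (μ.comap ((↑) : K → X)) :=
    g.continuous.integrable_of_hasCompactSupport (HasCompactSupport.of_compactSpace g)
  have key : ∃ q : ℝ[X], ∀ t : ℝ, q.eval t =
      ∫ x : K, p.eval (algebraMap ℝ C(K, ℝ) t) x ∂(μ.comap (↑)) := by
    induction p using Polynomial.induction_on' with
    | add p q hp hq =>
      obtain ⟨p', hp⟩ := hp
      obtain ⟨q', hq⟩ := hq
      refine ⟨p' + q', fun t ↦ ?_⟩
      rw [eval_add, hp, hq, ← integral_add (hint _) (hint _)]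
      simp
    | monomial n a =>
      refine ⟨monomial n (∫ x : K, a x ∂(μ.comap (↑))), fun t ↦ ?_⟩
      simp [integral_mul_const]
  obtain ⟨q, hq⟩ := key
  refine ⟨q, fun t u hu ↦ ?_⟩
  rw [hq, ← integral_subtype_comap hK.measurableSet]
  exact integral_congr_ae (.of_forall hu)

section
variable {E : Type*} [NormedAddCommGroup E] [NormedSpace ℝ E] [MeasurableSpace E] (μ : Measure E)

/-- The integral over `K` of the pullback under `f` of the top-degree form with density `h`. -/
noncomputable def jacobianIntegral (K : Set E) (h : E → ℝ) (f : E → E) : ℝ :=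
  ∫ x in K, (fderiv ℝ f x).det * h (f x) ∂μ

theorem jacobianIntegral_eq_zero {K : Set E} {h : E → ℝ} {f : E → E} (H : ∀ x ∈ K, h (f x) = 0) :
    jacobianIntegral μ K h f = 0 :=
  setIntegral_eq_zero_of_forall_eq_zero fun x hx ↦ by rw [H x hx, mul_zero]

/-- All smooth approximations of `F` on `closedBall 0 2` have local degree zero at `y`. -/
def LocalDegreeVanishes (F : E → E) (y : E) : Prop :=
  ∃ δ > 0, ∀ f : E → E, ContDiff ℝ 1 f → (∀ x ∈ closedBall 0 2, dist (f x) (F x) < δ) →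
    ∀ h : E → ℝ, Continuous h → (∀ z, δ ≤ dist z y → h z = 0) →
      jacobianIntegral μ (closedBall 0 2) h f = 0

theorem isOpen_setOf_localDegreeVanishes (F : E → E) :
    IsOpen {y | LocalDegreeVanishes μ F y} := by
  refine Metric.isOpen_iff.2 fun y ⟨δ, hδ, H⟩ ↦ ⟨δ / 2, half_pos hδ, fun y' hy' ↦
    ⟨δ / 2, half_pos hδ, fun f hf hfF h hh hsupp ↦
      H f hf (fun x hx ↦ (hfF x hx).trans (half_lt_self hδ)) h hh fun z hz ↦ hsupp z ?_⟩⟩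
  have := dist_triangle z y' y
  rw [mem_ball] at hy'
  linarith

theorem LocalDegreeVanishes.of_notMem_image [FiniteDimensional ℝ E] {F : E → E} (hF : Continuous F)
    {y : E} (hy : y ∉ F '' closedBall 0 2) : LocalDegreeVanishes μ F y := by
  have hcl : IsClosed (F '' closedBall 0 2) := ((isCompact_closedBall 0 2).image hF).isClosed
  obtain ⟨δ, hδ, H⟩ := Metric.isOpen_iff.1 hcl.isOpen_compl y hy
  refine ⟨δ / 2, half_pos hδ, fun f _ hfF h _ hsupp ↦
    jacobianIntegral_eq_zero μ (fun x hx ↦ hsupp _ ?_)⟩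
  by_contra! hlt
  refine H (mem_ball.2 ?_) (mem_image_of_mem F hx)
  have := dist_triangle_left (F x) y (f x)
  linarith [hfF x hx]

end

section
variable {E : Type*} [NormedAddCommGroup E] [NormedSpace ℝ E]

theorem exists_polynomial_eval_eq_comp_add_smul (K : Set E) {f : E → E} (hf : Continuous f)
    {h : C(E, ℝ)}
    (hh : h ∈ Algebra.adjoin ℝ (range fun l : StrongDual ℝ E ↦ (⟨l, l.continuous⟩ : C(E, ℝ)))) :
    ∃ p : C(K, ℝ)[X], ∀ (t : ℝ) (x : K),
      p.eval (algebraMap ℝ C(K, ℝ) t) x = h (f x + t • (x : E)) := by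
  induction hh using Algebra.adjoin_induction with
  | mem h hh =>
    obtain ⟨l, rfl⟩ := hh
    refine ⟨C ⟨fun x ↦ l (f x), by fun_prop⟩ + X * C ⟨fun x ↦ l x, by fun_prop⟩, fun t x ↦ ?_⟩
    simp [mul_comm t]
  | algebraMap r => exact ⟨C (algebraMap ℝ _ r), fun t x ↦ by simp⟩
  | add h k _ _ ih ik =>
    obtain ⟨p, hp⟩ := ih
    obtain ⟨q, hq⟩ := ik
    exact ⟨p + q, fun t x ↦ by simp [hp, hq]⟩
  | mul h k _ _ ih ik =>
    obtain ⟨p, hp⟩ := ih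
    obtain ⟨q, hq⟩ := ik
    exact ⟨p * q, fun t x ↦ by simp [hp, hq]⟩

theorem LipschitzWith.bijective_add_smul [CompleteSpace E] {f : E → E} {L : NNReal}
    (hf : LipschitzWith L f) {t : ℝ} (ht : L < t) :
    Function.Bijective fun x ↦ f x + t • x := by
  have ht0 : 0 < t := L.coe_nonneg.trans_lt ht
  refine ⟨fun x y hxy ↦ ?_, fun y ↦ ?_⟩
  · have h1 : t • (x - y) = f y - f x := by
      rw [smul_sub, sub_eq_sub_iff_add_eq_add, add_comm, add_comm (f y)]
      simpa [add_comm] using hxy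
    have h2 : t * ‖x - y‖ ≤ L * ‖x - y‖ := by
      rw [← abs_of_pos ht0, ← Real.norm_eq_abs, ← norm_smul, h1, norm_sub_rev x y]
      exact hf.norm_sub_le y x
    by_contra hne
    have : 0 < ‖x - y‖ := norm_pos_iff.2 (sub_ne_zero.2 hne)
    nlinarith
  · have hc : ContractingWith (L * ‖t⁻¹‖₊) fun x ↦ t⁻¹ • (y - f x) := by
      constructor
      · rw [← NNReal.coe_lt_coe]
        simp only [NNReal.coe_mul, coe_nnnorm, norm_inv, Real.norm_eq_abs, abs_of_pos ht0,
          NNReal.coe_one]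
        rwa [← div_eq_mul_inv, div_lt_one ht0]
      · refine LipschitzWith.of_dist_le_mul fun x z ↦ ?_
        rw [dist_smul₀, dist_sub_left, NNReal.coe_mul, coe_nnnorm, mul_comm (L : ℝ), mul_assoc]
        gcongr
        exact hf.dist_le_mul x z
    refine ⟨hc.fixedPoint, ?_⟩
    have h := hc.fixedPoint_isFixedPt
    rw [Function.IsFixedPt, inv_smul_eq_iff₀ ht0.ne'] at h
    simp only [← h, add_sub_cancel]

variable [FiniteDimensional ℝ E]

theorem exists_polynomial_eval_eq_det_add_smul_id (K : Set E) {A : E → E →L[ℝ] E}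
    (hA : Continuous A) :
    ∃ p : C(K, ℝ)[X], ∀ (t : ℝ) (x : K),
      p.eval (algebraMap ℝ C(K, ℝ) t) x = (A x + t • ContinuousLinearMap.id ℝ E).det := by
  classical
  set b := Module.finBasis ℝ E
  have hcont (i j) : Continuous fun x : K ↦ b.repr (A x (b j)) i := by
    have : Continuous fun v ↦ b.repr v i := (b.coord i).continuous_of_finiteDimensional
    exact this.comp (by fun_prop)
  refine ⟨(Matrix.of fun i j ↦ (C ⟨_, hcont i j⟩ + X * C (algebraMap ℝ _ (b.repr (b j) i)) :
    C(K, ℝ)[X])).det, fun t x ↦ ?_⟩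
  have hev : ∀ q : C(K, ℝ)[X], q.eval (algebraMap ℝ C(K, ℝ) t) x =
    ((ContinuousMap.evalAlgHom ℝ ℝ x : C(K, ℝ) →+* ℝ).comp
      (evalRingHom (algebraMap ℝ C(K, ℝ) t))) q := fun q ↦ rfl
  rw [hev, RingHom.map_det, ContinuousLinearMap.det, ← LinearMap.det_toMatrix b]
  congr 1
  ext i j
  rw [LinearMap.toMatrix_apply]
  by_cases hij : j = i <;> simp [Finsupp.single_apply, hij]

theorem eventually_forall_det_add_smul_id_pos (L : ℝ) :
    ∀ᶠ t : ℝ in Filter.atTop, ∀ A : E →L[ℝ] E, ‖A‖ ≤ L →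
      0 < (A + t • ContinuousLinearMap.id ℝ E).det := by
  have h1 : ∀ᶠ A : E →L[ℝ] E in nhds (ContinuousLinearMap.id ℝ E), 0 < A.det :=
    (ContinuousLinearMap.continuous_det.continuousAt).eventually_const_lt
      (by simp [ContinuousLinearMap.det])
  obtain ⟨δ, hδ, h⟩ := Metric.eventually_nhds_iff.1 h1
  filter_upwards [Filter.eventually_gt_atTop (L / δ), Filter.eventually_gt_atTop 0]
    with t ht ht0 A hA
  have h2 : A + t • ContinuousLinearMap.id ℝ E =
      t • (t⁻¹ • A + ContinuousLinearMap.id ℝ E) := by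
    rw [smul_add, smul_inv_smul₀ ht0.ne']
  rw [h2, ContinuousLinearMap.det, ContinuousLinearMap.toLinearMap_smul, LinearMap.det_smul]
  refine mul_pos (by positivity) (h ?_)
  rw [dist_eq_norm, add_sub_cancel_right, norm_smul, norm_inv, Real.norm_eq_abs, abs_of_pos ht0,
    inv_mul_lt_iff₀ ht0]
  rw [div_lt_iff₀ hδ] at ht
  exact hA.trans_lt ht

theorem exists_pos_forall_shell_le {u : E → ℝ} (hu : Continuous u)
    (hpos : ∀ x : E, 1 ≤ ‖x‖ → 0 < u x) :
    ∃ δ > 0, ∀ x : E, 1 ≤ ‖x‖ → ‖x‖ ≤ 2 → δ ≤ u x := by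
  have hc : IsCompact (closedBall (0 : E) 2 ∩ {x | 1 ≤ ‖x‖}) :=
    (isCompact_closedBall 0 2).inter_right (isClosed_le continuous_const continuous_norm)
  obtain ⟨δ, hδ, H⟩ := hc.exists_forall_le' hu.continuousOn (fun x hx ↦ hpos x hx.2)
  exact ⟨δ, hδ, fun x h1 h2 ↦ H x ⟨mem_closedBall_zero_iff.2 h2, h1⟩⟩

/-- A continuous injective map on the closed unit ball has a globally defined continuous left
inverse. -/
theorem exists_continuous_leftInverse {F : E → E} (hF : Continuous F)
    (hinj : InjOn F (closedBall 0 1)) :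
    ∃ Φ : E → E, Continuous Φ ∧ ∀ x ∈ closedBall 0 1, Φ (F x) = x := by
  have : CompactSpace (closedBall (0 : E) 1) :=
    isCompact_iff_compactSpace.1 (isCompact_closedBall 0 1)
  have he : Topology.IsClosedEmbedding fun x : closedBall (0 : E) 1 ↦ F x :=
    Continuous.isClosedEmbedding (by fun_prop) (injOn_iff_injective.1 hinj)
  obtain ⟨Φ, hΦ⟩ := ContinuousMap.exists_extension' he
    (⟨Subtype.val, continuous_subtype_val⟩ : C(closedBall (0 : E) 1, E))
  exact ⟨Φ, Φ.continuous, fun x hx ↦ congrFun hΦ ⟨x, hx⟩⟩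

variable [MeasurableSpace E] [BorelSpace E]

variable (μ : Measure E) [μ.IsAddHaarMeasure] {K : Set E}

theorem jacobianIntegral_add_smul_eq (hK : MeasurableSet K) {f g : E → E} {L : NNReal}
    (hf : ContDiff ℝ 1 f) (hg : ContDiff ℝ 1 g) (hfL : LipschitzWith L f)
    (hgL : LipschitzWith L g) (hfg : EqOn f g Kᶜ) (h : E → ℝ) :
    ∀ᶠ t : ℝ in Filter.atTop, jacobianIntegral μ K h (fun x ↦ f x + t • x) =
      jacobianIntegral μ K h (fun x ↦ g x + t • x) := by
  filter_upwards [eventually_forall_det_add_smul_id_pos (E := E) L,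
    Filter.eventually_gt_atTop (L : ℝ)] with t hdet ht
  have key : ∀ f : E → E, ContDiff ℝ 1 f → LipschitzWith L f →
      jacobianIntegral μ K h (fun x ↦ f x + t • x) =
        ∫ y in (fun x ↦ f x + t • x) '' K, h y ∂μ := by
    intro f hf hfL
    have hd (x) : HasFDerivAt (fun x ↦ f x + t • x)
        (fderiv ℝ f x + t • ContinuousLinearMap.id ℝ E) x :=
      (hf.differentiable one_ne_zero x).hasFDerivAt.add ((hasFDerivAt_id x).const_smul t)
    rw [integral_image_eq_integral_abs_det_fderiv_smul μ hK
      (fun x _ ↦ (hd x).hasFDerivWithinAt) (hfL.bijective_add_smul ht).injective.injOn]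
    refine integral_congr_ae (.of_forall fun x ↦ ?_)
    simp only [(hd x).fderiv, smul_eq_mul]
    rw [abs_of_pos (hdet _ (norm_fderiv_le_of_lipschitz ℝ hfL))]
  rw [key f hf hfL, key g hg hgL]
  have himg : (fun x ↦ f x + t • x) '' Kᶜ = (fun x ↦ g x + t • x) '' Kᶜ :=
    image_congr fun x hx ↦ by rw [hfg hx]
  rw [image_compl_eq (hfL.bijective_add_smul ht), image_compl_eq (hgL.bijective_add_smul ht),
    compl_inj_iff] at himg
  rw [himg]

theorem jacobianIntegral_congr_of_mem_adjoin (hK : IsCompact K) {f g : E → E}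
    (hf : ContDiff ℝ 1 f) (hg : ContDiff ℝ 1 g) (hfc : HasCompactSupport f)
    (hgc : HasCompactSupport g) (hfg : EqOn f g Kᶜ) {h : C(E, ℝ)}
    (hh : h ∈ Algebra.adjoin ℝ (range fun l : StrongDual ℝ E ↦ (⟨l, l.continuous⟩ : C(E, ℝ)))) :
    jacobianIntegral μ K h f = jacobianIntegral μ K h g := by
  have key : ∀ f : E → E, ContDiff ℝ 1 f → ∃ q : ℝ[X], ∀ t : ℝ,
      q.eval t = jacobianIntegral μ K h (fun x ↦ f x + t • x) := by
    intro f hf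
    obtain ⟨p₁, hp₁⟩ := exists_polynomial_eval_eq_comp_add_smul K hf.continuous hh
    obtain ⟨p₂, hp₂⟩ := exists_polynomial_eval_eq_det_add_smul_id K
      (hf.continuous_fderiv one_ne_zero)
    obtain ⟨q, hq⟩ := exists_polynomial_eval_eq_setIntegral μ hK (p₂ * p₁)
    refine ⟨q, fun t ↦ hq t _ fun x ↦ ?_⟩
    have hd : HasFDerivAt (fun x ↦ f x + t • x)
        (fderiv ℝ f x + t • ContinuousLinearMap.id ℝ E) (x : E) :=
      (hf.differentiable one_ne_zero x).hasFDerivAt.add ((hasFDerivAt_id _).const_smul t)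
    rw [eval_mul, ContinuousMap.mul_apply, hp₁, hp₂, hd.fderiv]
  obtain ⟨p, hp⟩ := key f hf
  obtain ⟨q, hq⟩ := key g hg
  obtain ⟨L₁, hL₁⟩ := hf.lipschitzWith_of_hasCompactSupport hfc one_ne_zero
  obtain ⟨L₂, hL₂⟩ := hg.lipschitzWith_of_hasCompactSupport hgc one_ne_zero
  have hev := jacobianIntegral_add_smul_eq μ hK.measurableSet hf hg
    (hL₁.weaken (le_max_left L₁ L₂)) (hL₂.weaken (le_max_right L₁ L₂)) hfg h
  have hpq : p = q := by
    obtain ⟨T, hT⟩ := Filter.eventually_atTop.1 hev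
    refine Polynomial.eq_of_infinite_eval_eq p q ((Set.Ici_infinite T).mono fun t ht ↦ ?_)
    rw [mem_ofPred_eq, hp, hq, hT t ht]
  simpa [hpq, hq] using (hp 0).symm

theorem jacobianIntegral_congr_of_hasCompactSupport (hK : IsCompact K) {f g : E → E}
    (hf : ContDiff ℝ 1 f) (hg : ContDiff ℝ 1 g) (hfc : HasCompactSupport f)
    (hgc : HasCompactSupport g) (hfg : EqOn f g Kᶜ) {h : E → ℝ} (hh : Continuous h) :
    jacobianIntegral μ K h f = jacobianIntegral μ K h g := by
  have hcont : ∀ f : E → E, ContDiff ℝ 1 f → Continuous fun x ↦ (fderiv ℝ f x).det :=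
    fun f hf ↦ ContinuousLinearMap.continuous_det.comp (hf.continuous_fderiv one_ne_zero)
  have happrox : ∀ f : E → E, ContDiff ℝ 1 f → ∀ k : E → ℝ, Continuous k → ∀ ε : ℝ,
      (∀ y ∈ f '' K, ‖k y - h y‖ < ε) →
      ‖jacobianIntegral μ K k f - jacobianIntegral μ K h f‖ ≤
        ε * ∫ x in K, ‖(fderiv ℝ f x).det‖ ∂μ := by
    intro f hf k hk ε hε
    have hint : ∀ k : E → ℝ, Continuous k →
        IntegrableOn (fun x ↦ (fderiv ℝ f x).det * k (f x)) K μ := fun k hk ↦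
      ((hcont f hf).mul (hk.comp hf.continuous)).continuousOn.integrableOn_compact hK
    rw [jacobianIntegral, jacobianIntegral, ← integral_sub (hint k hk) (hint h hh),
      ← integral_const_mul]
    refine norm_integral_le_of_norm_le
      (((hcont f hf).norm.continuousOn.integrableOn_compact hK).const_mul ε) ?_
    filter_upwards [ae_restrict_mem hK.measurableSet] with x hx
    rw [← mul_sub, norm_mul, mul_comm]
    gcongr
    exact (hε _ (mem_image_of_mem f hx)).le
  set M := (∫ x in K, ‖(fderiv ℝ f x).det‖ ∂μ) + ∫ x in K, ‖(fderiv ℝ g x).det‖ ∂μ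
  have hM : 0 ≤ M := by positivity
  have hsep : (Algebra.adjoin ℝ
      (range fun l : StrongDual ℝ E ↦ (⟨l, l.continuous⟩ : C(E, ℝ)))).SeparatesPoints := by
    intro x y hxy
    obtain ⟨l, hl⟩ := SeparatingDual.exists_separating_of_ne (R := ℝ) hxy
    exact ⟨l, ⟨⟨l, l.continuous⟩, Algebra.subset_adjoin ⟨l, rfl⟩, rfl⟩, hl⟩
  refine eq_of_forall_dist_le fun ε hε ↦ ?_
  have hδ : 0 < ε / (M + 1) := by positivity
  obtain ⟨k, hkA, hk⟩ :=
    ContinuousMap.exists_mem_subalgebra_near_continuous_of_isCompact_of_separatesPoints hsep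
      ⟨h, hh⟩ ((hK.image hf.continuous).union (hK.image hg.continuous)) hδ
  have h1 := happrox f hf k k.continuous _ fun y hy ↦ hk y (.inl hy)
  have h2 := happrox g hg k k.continuous _ fun y hy ↦ hk y (.inr hy)
  rw [jacobianIntegral_congr_of_mem_adjoin μ hK hf hg hfc hgc hfg hkA] at h1
  calc dist (jacobianIntegral μ K h f) (jacobianIntegral μ K h g)
      ≤ ‖jacobianIntegral μ K k g - jacobianIntegral μ K h f‖ +
        ‖jacobianIntegral μ K k g - jacobianIntegral μ K h g‖ := by
        rw [← dist_eq_norm, ← dist_eq_norm]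
        exact dist_triangle_left _ _ _
    _ ≤ ε / (M + 1) * M := by
        rw [mul_add]
        exact add_le_add h1 h2
    _ ≤ ε := by
        rw [div_mul_eq_mul_div, div_le_iff₀ (by positivity)]
        nlinarith

/-- The Jacobian integral over a ball depends only on the values of the map off the ball. -/
theorem jacobianIntegral_congr {R : ℝ} {f g : E → E}
    (hf : ContDiff ℝ 1 f) (hg : ContDiff ℝ 1 g) (hfg : EqOn f g (closedBall 0 R)ᶜ)
    {h : E → ℝ} (hh : Continuous h) :
    jacobianIntegral μ (closedBall 0 R) h f = jacobianIntegral μ (closedBall 0 R) h g := by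
  let χ : ContDiffBump (0 : E) := ⟨|R| + 1, |R| + 2, by positivity, by linarith⟩
  have hcut : ∀ f : E → E, jacobianIntegral μ (closedBall 0 R) h (fun x ↦ χ x • f x) =
      jacobianIntegral μ (closedBall 0 R) h f := by
    intro f
    refine setIntegral_congr_fun measurableSet_closedBall fun x hx ↦ ?_
    have hx' : x ∈ ball (0 : E) χ.rIn :=
      closedBall_subset_ball (show R < |R| + 1 by linarith [le_abs_self R]) hx
    have hev : (fun x ↦ χ x • f x) =ᶠ[nhds x] f := by
      filter_upwards [χ.eventuallyEq_one_of_mem_ball hx'] with y hy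
      simp [hy]
    simp only [hev.fderiv_eq, hev.eq_of_nhds]
  rw [← hcut f, ← hcut g]
  refine jacobianIntegral_congr_of_hasCompactSupport μ (isCompact_closedBall 0 R)
    (χ.contDiff.smul hf) (χ.contDiff.smul hg) χ.hasCompactSupport.smul_right
    χ.hasCompactSupport.smul_right (fun x hx ↦ ?_) hh
  change χ x • f x = χ x • g x
  rw [hfg hx]

/-- Homotopy invariance: the linear homotopy avoids the support of `h` on the outer shell. -/
theorem jacobianIntegral_eq_of_shell {R₁ R₂ : ℝ} (hR₁ : 0 < R₁) (hR : R₁ < R₂) {f g : E → E}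
    (hf : ContDiff ℝ 1 f) (hg : ContDiff ℝ 1 g) {h : E → ℝ} (hh : Continuous h)
    (hfg : ∀ x, R₁ ≤ ‖x‖ → ‖x‖ ≤ R₂ → ∀ t ∈ Icc (0 : ℝ) 1, h (g x + t • (f x - g x)) = 0) :
    jacobianIntegral μ (closedBall 0 R₂) h f = jacobianIntegral μ (closedBall 0 R₂) h g := by
  let χ : ContDiffBump (0 : E) := ⟨R₁, R₂, hR₁, hR⟩
  set k : E → E := fun x ↦ g x + χ x • (f x - g x)
  have hk : ContDiff ℝ 1 k := hg.add (χ.contDiff.smul (hf.sub hg))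
  have hkg : EqOn k g (closedBall 0 R₂)ᶜ := fun x hx ↦ by
    have : χ x = 0 := χ.zero_of_le_dist (le_of_not_ge hx)
    simp [k, this]
  rw [← jacobianIntegral_congr μ hk hg hkg hh]
  refine setIntegral_congr_fun measurableSet_closedBall fun x hx ↦ ?_
  rw [mem_closedBall_zero_iff] at hx
  rcases lt_or_ge ‖x‖ R₁ with hx' | hx'
  · have hev : k =ᶠ[nhds x] f := by
      filter_upwards [χ.eventuallyEq_one_of_mem_ball (mem_ball_zero_iff.2 hx')] with y hy
      simp [k, hy]
    simp only [hev.fderiv_eq, hev.eq_of_nhds]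
  · have h1 := hfg x hx' hx 1 (by simp)
    have h2 := hfg x hx' hx (χ x) ⟨χ.nonneg, χ.le_one⟩
    simp only [one_smul, add_sub_cancel] at h1
    simp only [h1, k, h2, mul_zero]

theorem LocalDegreeVanishes.zero_of_forall_ne_zero {F G : E → E} (hF : Continuous F)
    (hG : Continuous G) (hG0 : ∀ x, G x ≠ 0) (hFG : ∀ x, 1 ≤ ‖x‖ → ‖G x - F x‖ < ‖F x‖) :
    LocalDegreeVanishes μ F 0 := by
  obtain ⟨δ₁, hδ₁, H₁⟩ := exists_pos_forall_shell_le (u := fun x ↦ ‖F x‖ - ‖G x - F x‖)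
    (by fun_prop) fun x hx ↦ sub_pos.2 (hFG x hx)
  obtain ⟨δ₂, hδ₂, H₂⟩ := (isCompact_closedBall (0 : E) 2).exists_forall_le'
    hG.norm.continuousOn (fun x _ ↦ norm_pos_iff.2 (hG0 x))
  set δ := min δ₁ δ₂
  have hδ : 0 < δ := lt_min hδ₁ hδ₂
  obtain ⟨g, hg, hgG, -⟩ := hG.exists_contDiff_approx 1 (ε := fun _ ↦ δ / 2) continuous_const
    fun _ ↦ half_pos hδ
  refine ⟨δ / 2, half_pos hδ, fun f hf hfF h hh hsupp ↦ ?_⟩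
  simp only [dist_zero_right] at hsupp
  rw [jacobianIntegral_eq_of_shell μ one_pos one_lt_two hf hg hh fun x h1 h2 t ht ↦ ?_]
  · refine jacobianIntegral_eq_zero μ (fun x hx ↦ hsupp _ ?_)
    have h1 := norm_sub_norm_le (G x) (g x)
    have h2 := hgG x
    rw [dist_comm, dist_eq_norm] at h2
    linarith [H₂ x hx, min_le_right δ₁ δ₂]
  · refine hsupp _ ?_
    have e : g x + t • (f x - g x) = F x -
        ((1 - t) • (G x - g x) + t • (F x - f x) - (1 - t) • (G x - F x)) := by module
    have hg' := hgG x
    have hf' := hfF x (mem_closedBall_zero_iff.2 h2)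
    rw [dist_comm, dist_eq_norm] at hg' hf'
    have h3 : ‖(1 - t) • (G x - g x) + t • (F x - f x) - (1 - t) • (G x - F x)‖ ≤
        (1 - t) * (δ / 2) + t * (δ / 2) + 1 * ‖G x - F x‖ := by
      refine (norm_sub_le _ _).trans (add_le_add ((norm_add_le _ _).trans ?_) ?_)
      · rw [norm_smul, norm_smul, Real.norm_of_nonneg ht.1,
          Real.norm_of_nonneg (sub_nonneg.2 ht.2)]
        have := sub_nonneg.2 ht.2
        have := ht.1
        gcongr
      · rw [norm_smul, Real.norm_of_nonneg (sub_nonneg.2 ht.2)]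
        gcongr
        linarith [ht.1]
    rw [e]
    have h4 := norm_sub_norm_le (F x)
      ((1 - t) • (G x - g x) + t • (F x - f x) - (1 - t) • (G x - F x))
    linarith [H₁ x h1 h2, min_le_left δ₁ δ₂]

theorem LocalDegreeVanishes.of_mem_closure {F : E → E} (hF : Continuous F) {y : E}
    (hy : y ∈ closure {y | LocalDegreeVanishes μ F y}) (hyF : ∀ x, 1 ≤ ‖x‖ → F x ≠ y) :
    LocalDegreeVanishes μ F y := by
  obtain ⟨δ, hδ, H⟩ := exists_pos_forall_shell_le (u := fun x ↦ dist (F x) y)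
    (by fun_prop) fun x hx ↦ dist_pos.2 (hyF x hx)
  obtain ⟨z, ⟨ε, hε, hz⟩, hzy⟩ := Metric.mem_closure_iff.1 hy (δ / 3) (by positivity)
  refine ⟨min ε (δ / 3), by positivity, fun f hf hfF h hh hsupp ↦ ?_⟩
  have h1 : jacobianIntegral μ (closedBall 0 2) (fun w ↦ h (w - (z - y))) f = 0 :=
    hz f hf (fun x hx ↦ (hfF x hx).trans_le (min_le_left _ _)) _ (by fun_prop) fun w hw ↦
      hsupp _ ((min_le_left _ _).trans (by
        rwa [dist_eq_norm, sub_sub, sub_add_cancel, ← dist_eq_norm]))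
  have h2 : jacobianIntegral μ (closedBall 0 2) h (fun x ↦ f x - (z - y)) = 0 := by
    simpa only [jacobianIntegral, fderiv_sub_const] using h1
  rw [← h2]
  refine jacobianIntegral_eq_of_shell μ one_pos one_lt_two hf (hf.sub contDiff_const) hh
    fun x hx1 hx2 t ht ↦ hsupp _ ((min_le_right _ _).trans ?_)
  have h3 := (hfF x (mem_closedBall_zero_iff.2 hx2)).trans_le (min_le_right _ _)
  have h4 : dist (f x) (f x - (z - y) + t • (f x - (f x - (z - y)))) ≤ dist y z := by
    rw [dist_eq_norm, dist_eq_norm', show f x - (f x - (z - y) + t • (f x - (f x - (z - y)))) =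
      (1 - t) • (z - y) by module, norm_smul, Real.norm_of_nonneg (sub_nonneg.2 ht.2)]
    exact mul_le_of_le_one_left (norm_nonneg _) (by linarith [ht.1])
  have h5 := dist_triangle4 (F x) (f x) (f x - (z - y) + t • (f x - (f x - (z - y)))) y
  rw [dist_comm (F x) (f x)] at h5
  linarith [H x hx1 hx2]

theorem LocalDegreeVanishes.of_zero {F : E → E} (hF : Continuous F)
    (hinj : InjOn F (closedBall 0 1)) (hF0 : F 0 = 0)
    (hshell : ∀ x, 1 ≤ ‖x‖ → F x ∈ F '' sphere 0 1) (h0 : LocalDegreeVanishes μ F 0) {y : E}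
    (hy : y ∉ F '' sphere 0 1) : LocalDegreeVanishes μ F y := by
  by_cases hyB : y ∈ F '' ball 0 1
  · have hconn : IsPreconnected (F '' ball 0 1) :=
      (convex_ball 0 1).isPreconnected.image F hF.continuousOn
    refine hconn.subset_of_closure_inter_subset (isOpen_setOf_localDegreeVanishes μ F)
      ⟨0, ⟨0, mem_ball_self one_pos, hF0⟩, h0⟩ ?_ hyB
    rintro _ ⟨hcl, x, hx, rfl⟩
    refine of_mem_closure μ hF hcl fun x' hx' heq ↦ ?_
    obtain ⟨w, hw, hwF⟩ := hshell x' hx'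
    have : w = x := hinj (sphere_subset_closedBall hw) (ball_subset_closedBall hx)
      (hwF.trans heq)
    rw [this, mem_sphere] at hw
    exact (mem_ball.1 hx).ne hw
  · refine of_notMem_image μ hF ?_
    rintro ⟨x, -, rfl⟩
    rcases lt_or_ge ‖x‖ 1 with hx | hx
    · exact hyB ⟨x, mem_ball_zero_iff.2 hx, rfl⟩
    · exact hy (hshell x hx)

theorem exists_forall_jacobianIntegral_eq_zero {F : E → E} {T : Set E} (hT : IsCompact T)
    (H : ∀ y ∈ T, LocalDegreeVanishes μ F y) :
    ∃ δ > 0, ∀ f : E → E, ContDiff ℝ 1 f → (∀ x ∈ closedBall 0 2, dist (f x) (F x) < δ) →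
      ∀ h : E → ℝ, Continuous h → (∀ x ∈ closedBall 0 2, f x ∉ T → h (f x) = 0) →
        jacobianIntegral μ (closedBall 0 2) h f = 0 := by
  choose! δ hδ H using H
  obtain ⟨s, hsT, hs⟩ := hT.elim_nhds_subcover (fun y ↦ ball y (δ y))
    fun y hy ↦ ball_mem_nhds y (hδ y hy)
  let e := s.equivFin
  have hmem (i) : (e.symm i : E) ∈ T := hsT _ (e.symm i).2
  obtain ⟨φ, hφ, hφ1, -⟩ := exists_continuous_sum_one_of_isOpen_isCompact
    (s := fun i ↦ ball (e.symm i : E) (δ (e.symm i))) (fun i ↦ isOpen_ball) hT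
    fun y hy ↦ by
      obtain ⟨z, hz, hyz⟩ := mem_iUnion₂.1 (hs hy)
      exact mem_iUnion.2 ⟨e ⟨z, hz⟩, by simpa using hyz⟩
  have hev : ∀ᶠ η : ℝ in nhdsWithin 0 (Ioi 0), ∀ i, η < δ (e.symm i) :=
    Filter.eventually_all.2 fun i ↦
      nhdsWithin_le_nhds (eventually_lt_nhds (hδ _ (hmem i)))
  obtain ⟨η, hη, hη0⟩ := (hev.and self_mem_nhdsWithin).exists
  refine ⟨η, hη0, fun f hf hfF h hh hsupp ↦ ?_⟩
  have hpart (i) : jacobianIntegral μ (closedBall 0 2) (fun z ↦ φ i z * h z) f = 0 := by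
    refine H _ (hmem i) f hf (fun x hx ↦ (hfF x hx).trans (hη i)) _ (by fun_prop) fun z hz ↦ ?_
    rw [image_eq_zero_of_notMem_tsupport fun hz' ↦ (mem_ball.1 (hφ i hz')).not_ge hz, zero_mul]
  have hint (i) : IntegrableOn (fun x ↦ (fderiv ℝ f x).det * (φ i (f x) * h (f x)))
      (closedBall 0 2) μ := by
    have h1 : Continuous fun x ↦ (fderiv ℝ f x).det :=
      ContinuousLinearMap.continuous_det.comp (hf.continuous_fderiv one_ne_zero)
    have h2 := hf.continuous
    exact Continuous.continuousOn (by fun_prop) |>.integrableOn_compact (isCompact_closedBall 0 2)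
  rw [← Finset.sum_eq_zero fun i (_ : i ∈ Finset.univ) ↦ hpart i]
  simp only [jacobianIntegral]
  rw [← integral_finsetSum _ fun i _ ↦ hint i]
  refine setIntegral_congr_fun measurableSet_closedBall fun x hx ↦ ?_
  simp only [← Finset.mul_sum, ← Finset.sum_mul]
  by_cases hxT : f x ∈ T
  · have := hφ1 hxT
    rw [Finset.sum_apply, Pi.one_apply] at this
    rw [this, one_mul]
  · rw [hsupp x hx hxT]
    simp

theorem not_localDegreeVanishes_zero {F : E → E} (hF : Continuous F)
    (hinj : InjOn F (closedBall 0 1)) (hF0 : F 0 = 0)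
    (hshell : ∀ x : E, 1 ≤ ‖x‖ → F x = F (‖x‖⁻¹ • x)) : ¬ LocalDegreeVanishes μ F 0 := by
  intro h0
  have hsph : ∀ x : E, 1 ≤ ‖x‖ → ‖x‖⁻¹ • x ∈ sphere (0 : E) 1 := fun x hx ↦ by
    rw [mem_sphere_zero_iff_norm, norm_smul, norm_inv, norm_norm, inv_mul_cancel₀ (by linarith)]
  have hvan := fun y ↦ h0.of_zero μ hF hinj hF0 (y := y)
    fun x hx ↦ ⟨_, hsph x hx, (hshell x hx).symm⟩
  obtain ⟨Ψ, hΨ, hΨF⟩ := exists_continuous_leftInverse hF hinj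
  obtain ⟨Φ, hΦ, hΦΨ, -⟩ := hΨ.exists_contDiff_approx 1 (ε := fun _ ↦ 1 / 8) continuous_const
    fun _ ↦ by norm_num
  have hΦF : ∀ x : E, 1 ≤ ‖x‖ → ‖Φ (F x) - ‖x‖⁻¹ • x‖ < 1 / 8 := fun x hx ↦ by
    have := hΦΨ (F (‖x‖⁻¹ • x))
    rwa [hΨF _ (sphere_subset_closedBall (hsph x hx)), dist_eq_norm, ← hshell x hx] at this
  -- the compact set carrying the pulled back density
  set S := cthickening 1 (F '' closedBall 0 2)
  have hS : IsCompact S := ((isCompact_closedBall 0 2).image hF).cthickening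
  have hT : IsCompact (S ∩ {y | ‖Φ y‖ ≤ 1 / 4}) :=
    hS.inter_right (isClosed_le hΦ.continuous.norm continuous_const)
  obtain ⟨δ₁, hδ₁, H⟩ := exists_forall_jacobianIntegral_eq_zero μ hT fun y hy ↦ hvan y (by
    rintro ⟨x, hx, rfl⟩
    rw [mem_sphere_zero_iff_norm] at hx
    have h1 := hΦF x hx.ge
    have h2 := norm_sub_norm_le x (Φ (F x))
    rw [hx, inv_one, one_smul, norm_sub_rev] at h1
    have h3 : ‖Φ (F x)‖ ≤ 1 / 4 := hy.2
    linarith)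
  obtain ⟨δ₂, hδ₂, hunif⟩ := Metric.uniformContinuousOn_iff.1
    (hS.uniformContinuousOn_of_continuous hΦ.continuous.continuousOn) (1 / 8) (by norm_num)
  set δ := min δ₁ (min δ₂ 1)
  have hδ : 0 < δ := by positivity
  obtain ⟨f, hf, hfF, -⟩ := hF.exists_contDiff_approx 1 (ε := fun _ ↦ δ) continuous_const
    fun _ ↦ hδ
  have hfS : ∀ x ∈ closedBall 0 2, f x ∈ S := fun x hx ↦
    mem_cthickening_of_dist_le _ (F x) _ _ (mem_image_of_mem F hx)
      ((hfF x).le.trans ((min_le_right _ _).trans (min_le_right _ _)))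
  let ω : E → ℝ := fun z ↦ max 0 (1 / 4 - ‖z‖)
  have hω : Continuous ω := by fun_prop
  have hω0 : ∀ z, 1 / 4 ≤ ‖z‖ → ω z = 0 := fun z hz ↦ max_eq_left (by linarith)
  have hΦf : ContDiff ℝ 1 (Φ ∘ f) := hΦ.comp hf
  have hzero : jacobianIntegral μ (closedBall 0 2) ω (Φ ∘ f) = 0 := by
    rw [← H f hf (fun x _ ↦ (hfF x).trans_le (min_le_left _ _))
      (fun y ↦ (fderiv ℝ Φ y).det * ω (Φ y))
      ((ContinuousLinearMap.continuous_det.comp (hΦ.continuous_fderiv one_ne_zero)).mul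
        (hω.comp hΦ.continuous)) fun x hx hxT ↦ ?_]
    · refine setIntegral_congr_fun measurableSet_closedBall fun x _ ↦ ?_
      simp only [Function.comp_apply]
      rw [fderiv_comp x (hΦ.differentiable one_ne_zero _) (hf.differentiable one_ne_zero _),
        ContinuousLinearMap.det, ContinuousLinearMap.toLinearMap_comp, LinearMap.det_comp]
      simp only [ContinuousLinearMap.det]
      ring
    · rw [hω0 _ (not_le.1 fun hle ↦ hxT ⟨hfS x hx, hle⟩).le, mul_zero]
  have hid : jacobianIntegral μ (closedBall 0 2) ω (Φ ∘ f) =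
      jacobianIntegral μ (closedBall 0 2) ω id := by
    refine jacobianIntegral_eq_of_shell μ one_pos one_lt_two hΦf contDiff_id hω
      fun x hx1 hx2 t ht ↦ hω0 _ ?_
    have hx : x ∈ closedBall (0 : E) 2 := mem_closedBall_zero_iff.2 hx2
    have h1 := hunif (f x) (hfS x hx) (F x)
      (self_subset_cthickening _ (mem_image_of_mem F hx))
      ((hfF x).trans_le ((min_le_right _ _).trans (min_le_left _ _)))
    rw [dist_eq_norm] at h1
    have h2 := hΦF x hx1
    set d := (Φ (f x) - Φ (F x)) + (Φ (F x) - ‖x‖⁻¹ • x)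
    have hd : ‖d‖ ≤ 1 / 4 := (norm_add_le _ _).trans (by linarith)
    have e : id x + t • ((Φ ∘ f) x - id x) = ((1 - t) + t * ‖x‖⁻¹) • x + t • d := by
      simp only [id, Function.comp_apply, d]
      module
    have ht' := sub_nonneg.2 ht.2
    have h3 : 1 ≤ ‖((1 - t) + t * ‖x‖⁻¹) • x‖ := by
      have := ht.1
      rw [norm_smul, Real.norm_of_nonneg (by positivity), add_mul, mul_assoc,
        inv_mul_cancel₀ (by linarith)]
      nlinarith
    have h4 : ‖t • d‖ ≤ 1 / 4 := by
      rw [norm_smul, Real.norm_of_nonneg ht.1]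
      nlinarith [norm_nonneg d, ht.1, ht.2]
    have h5 := norm_sub_le_norm_add (((1 - t) + t * ‖x‖⁻¹) • x) (t • d)
    rw [e]
    linarith
  have hpos : 0 < jacobianIntegral μ (closedBall 0 2) ω id := by
    simp only [jacobianIntegral, fderiv_id, id]
    rw [integral_const_mul]
    refine mul_pos (by simp [ContinuousLinearMap.det]) ?_
    rw [setIntegral_pos_iff_support_of_nonneg_ae (f := ω) (.of_forall fun z ↦ le_max_left _ _)
      (hω.continuousOn.integrableOn_compact (isCompact_closedBall 0 2))]
    refine (measure_ball_pos μ (0 : E) (show (0 : ℝ) < 1 / 4 by norm_num)).trans_le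
      (measure_mono fun z hz ↦ ?_)
    rw [mem_ball_zero_iff] at hz
    refine ⟨?_, mem_closedBall_zero_iff.2 (by linarith)⟩
    exact (lt_max_of_lt_right (sub_pos.2 hz)).ne'
  exact hpos.ne' (hid.symm.trans hzero)

end

section
variable {E : Type*} [NormedAddCommGroup E] [NormedSpace ℝ E]

/-- The radial retraction onto the closed unit ball. -/
noncomputable def unitBallRetraction (x : E) : E := (max 1 ‖x‖)⁻¹ • x

theorem continuous_unitBallRetraction : Continuous (unitBallRetraction : E → E) :=
  ((continuous_const.max continuous_norm).inv₀ fun x ↦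
    (zero_lt_one.trans_le (le_max_left 1 ‖x‖)).ne').smul continuous_id

theorem norm_unitBallRetraction_le (x : E) : ‖unitBallRetraction x‖ ≤ 1 := by
  have h : 0 < max 1 ‖x‖ := zero_lt_one.trans_le (le_max_left 1 ‖x‖)
  rw [unitBallRetraction, norm_smul, norm_inv, Real.norm_of_nonneg h.le, inv_mul_le_iff₀ h,
    mul_one]
  exact le_max_right _ _

theorem unitBallRetraction_of_norm_le {x : E} (hx : ‖x‖ ≤ 1) : unitBallRetraction x = x := by
  simp [unitBallRetraction, max_eq_left hx]

theorem unitBallRetraction_of_le_norm {x : E} (hx : 1 ≤ ‖x‖) :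
    unitBallRetraction x = ‖x‖⁻¹ • x := by
  simp [unitBallRetraction, max_eq_right hx]

/-- The Rouché-type statement on the unit ball, with target value zero. -/
theorem exists_eq_zero_of_unit_sphere_perturbation [FiniteDimensional ℝ E] {F G : E → E}
    (hF : ContinuousOn F (closedBall 0 1)) (hG : ContinuousOn G (closedBall 0 1))
    (hinj : InjOn F (closedBall 0 1)) (hF0 : F 0 = 0)
    (hlt : ∀ x ∈ sphere (0 : E) 1, ‖G x - F x‖ < ‖F x‖) : ∃ x ∈ closedBall 0 1, G x = 0 := by
  borelize E
  by_contra! hG0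
  have hmem (x : E) : unitBallRetraction x ∈ closedBall (0 : E) 1 :=
    mem_closedBall_zero_iff.2 (norm_unitBallRetraction_le x)
  have hsph {x : E} (hx : 1 ≤ ‖x‖) : ‖‖x‖⁻¹ • x‖ = 1 := by
    rw [norm_smul, norm_inv, norm_norm, inv_mul_cancel₀ (by linarith)]
  have hF' : Continuous fun x ↦ F (unitBallRetraction x) :=
    hF.comp_continuous continuous_unitBallRetraction hmem
  have hG' : Continuous fun x ↦ G (unitBallRetraction x) :=
    hG.comp_continuous continuous_unitBallRetraction hmem
  have hball : EqOn (fun x ↦ F (unitBallRetraction x)) F (closedBall 0 1) := fun x hx ↦ by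
    simp only [unitBallRetraction_of_norm_le (mem_closedBall_zero_iff.1 hx)]
  refine not_localDegreeVanishes_zero Measure.addHaar hF' (hinj.congr hball.symm)
    (by rw [unitBallRetraction_of_norm_le (by simp), hF0]) (fun x hx ↦ ?_)
    (LocalDegreeVanishes.zero_of_forall_ne_zero _ hF' hG' (fun x ↦ hG0 _ (hmem x))
      fun x hx ↦ ?_)
  · rw [unitBallRetraction_of_le_norm hx, unitBallRetraction_of_norm_le (hsph hx).le]
  · rw [unitBallRetraction_of_le_norm hx]
    exact hlt _ (mem_sphere_zero_iff_norm.2 (hsph hx))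

end

/-- Rouché-type degree statement: if `F` is continuous and injective on a closed ball
in `ℝ^m` and `G` is continuous on the ball with `‖G x - F x‖ < ‖F x - F c‖` on the
boundary sphere, then `G` attains the value `F c` somewhere in the closed ball. -/
theorem exists_eq_center_image_of_boundary_perturbation
    (m : ℕ) (hm : 1 ≤ m) (c : EuclideanSpace ℝ (Fin m)) (r : ℝ) (hr : 0 < r)
    (F G : EuclideanSpace ℝ (Fin m) → EuclideanSpace ℝ (Fin m))
    (hF : ContinuousOn F (Metric.closedBall c r))
    (hG : ContinuousOn G (Metric.closedBall c r))
    (hFinj : Set.InjOn F (Metric.closedBall c r))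
    (hlt : ∀ x ∈ Metric.sphere c r, ‖G x - F x‖ < ‖F x - F c‖) :
    ∃ x ∈ Metric.closedBall c r, G x = F c := by
  have hmaps : MapsTo (fun x : EuclideanSpace ℝ (Fin m) ↦ c + r • x) (closedBall 0 1)
      (closedBall c r) := fun x hx ↦ by
    rw [mem_closedBall_zero_iff] at hx
    rw [mem_closedBall, dist_self_add_left, norm_smul, Real.norm_of_nonneg hr.le]
    exact mul_le_of_le_one_right hr.le hx
  have hcont : Continuous fun x : EuclideanSpace ℝ (Fin m) ↦ c + r • x := by fun_prop
  obtain ⟨x, hx, hGx⟩ := exists_eq_zero_of_unit_sphere_perturbation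
    (F := fun x ↦ F (c + r • x) - F c) (G := fun x ↦ G (c + r • x) - F c)
    ((hF.comp hcont.continuousOn hmaps).sub continuousOn_const)
    ((hG.comp hcont.continuousOn hmaps).sub continuousOn_const)
    (fun x hx y hy hxy ↦ by
      have h := hFinj (hmaps hx) (hmaps hy) (sub_left_injective hxy)
      exact smul_right_injective _ hr.ne' (add_left_cancel h))
    (by simp) (fun x hx ↦ by
      rw [mem_sphere_zero_iff_norm] at hx
      rw [sub_sub_sub_cancel_right]
      refine hlt _ ?_
      rw [mem_sphere, dist_self_add_left, norm_smul, Real.norm_of_nonneg hr.le, hx, mul_one])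
  exact ⟨_, hmaps hx, sub_eq_zero.1 hGx⟩
end

section
/- Let m ≥ 1 and let λ₁, …, λ_m : ℝ → ℝ be continuous and strictly monotone (each λᵢ either strictly increasing or strictly decreasing), and set lᵢ = λᵢ(1). Then for every r > 0 there exists δ > 0 with the following property: for every continuous map G : (Fin m → ℝ) → (Fin m → ℝ) such that |G x i - λᵢ(x i)| < δ for all i and all x in the box [1-r, 1+r]^m, there exists a point t ∈ [1-r, 1+r]^m with G t i = lᵢ for all i. -/
open MeasureTheory Set Filter Topology

/-- The determinant `det (1 + s • A)` is recovered by Lagrange interpolation from its values at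
`card ι + 1` distinct nodes. -/
theorem Matrix.det_one_add_smul_eq_sum_basis {ι : Type*} [Fintype ι] [DecidableEq ι]
    (A : Matrix ι ι ℝ) (v : ℕ → ℝ) (hv : Function.Injective v) (s : ℝ) :
    (1 + s • A).det = ∑ j ∈ Finset.range (Fintype.card ι + 1),
      (1 + v j • A).det *
        (Lagrange.basis (Finset.range (Fintype.card ι + 1)) v j).eval s := by
  set P : Polynomial ℝ := Matrix.det ((Polynomial.X : Polynomial ℝ) • A.map Polynomial.C +
    (1 : Matrix ι ι ℝ).map Polynomial.C) with hP
  have heval : ∀ t : ℝ, P.eval t = (1 + t • A).det := by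
    intro t
    rw [hP, ← Polynomial.coe_evalRingHom, RingHom.map_det]
    congr 1
    ext i j
    by_cases hij : i = j <;> simp [hij] <;> ring
  have hdeg : P.degree < (Finset.range (Fintype.card ι + 1)).card := by
    rw [Finset.card_range]
    refine Polynomial.degree_le_natDegree.trans_lt ?_
    exact_mod_cast Nat.lt_succ_of_le (Polynomial.natDegree_det_X_add_C_le A 1)
  have h := congrArg (Polynomial.eval s) (Lagrange.eq_interpolate hv.injOn hdeg)
  rw [heval, Lagrange.interpolate_apply, Polynomial.eval_finsetSum] at h
  simpa [heval] using h

/-- The determinant of `1 + s • A` is recovered by Lagrange interpolation from its values at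
`card ι + 1` distinct nodes. -/
theorem ContinuousLinearMap.det_one_add_smul_eq_sum_basis {ι : Type*} [Fintype ι]
    (A : (ι → ℝ) →L[ℝ] (ι → ℝ)) (v : ℕ → ℝ) (hv : Function.Injective v) (s : ℝ) :
    (1 + s • A).det = ∑ j ∈ Finset.range (Fintype.card ι + 1),
      (1 + v j • A).det *
        (Lagrange.basis (Finset.range (Fintype.card ι + 1)) v j).eval s := by
  classical
  have h : ∀ t : ℝ, (1 + t • A).det =
      (1 + t • LinearMap.toMatrix' (A : (ι → ℝ) →ₗ[ℝ] (ι → ℝ))).det := by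
    intro t
    rw [ContinuousLinearMap.det, ← LinearMap.det_toMatrix']
    congr 1
    simp [LinearMap.toMatrix'_one]
  simp only [h]
  exact Matrix.det_one_add_smul_eq_sum_basis _ v hv s

/-- A contraction perturbation of the identity that preserves each pair of opposite faces of the
unit cube maps the cube onto itself. -/
theorem surjOn_unitCube_of_lipschitzOnWith {ι : Type*} [Fintype ι] {f : (ι → ℝ) → ι → ℝ}
    {K : NNReal} (hK : K < 1) (hf : LipschitzOnWith K f (Icc 0 1))
    (h0 : ∀ x ∈ Icc (0 : ι → ℝ) 1, ∀ i, x i = 0 ∨ x i = 1 → f x i = 0) :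
    SurjOn (fun x ↦ x + f x) (Icc 0 1) (Icc 0 1) := by
  intro y hy
  set T : (ι → ℝ) → ι → ℝ :=
    fun x i ↦ (projIcc (0 : ℝ) 1 zero_le_one (y i - f x i) : ℝ) with hT
  have hmaps : MapsTo T (Icc 0 1) (Icc 0 1) := fun x _ ↦
    ⟨fun i ↦ (projIcc (0 : ℝ) 1 zero_le_one _).2.1, fun i ↦ (projIcc (0 : ℝ) 1 zero_le_one _).2.2⟩
  have hlip : LipschitzOnWith K T (Icc 0 1) := by
    refine LipschitzOnWith.of_dist_le_mul fun x hx z hz ↦ ?_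
    refine (dist_pi_le_iff (by positivity)).2 fun i ↦ ?_
    calc dist (T x i) (T z i) ≤ dist (y i - f x i) (y i - f z i) := by
          simpa only [NNReal.coe_one, one_mul] using!
            (LipschitzWith.projIcc (zero_le_one (α := ℝ))).dist_le_mul (y i - f x i) (y i - f z i)
      _ = dist (f x i) (f z i) := dist_sub_left _ _ _
      _ ≤ dist (f x) (f z) := dist_le_pi_dist _ _ i
      _ ≤ K * dist x z := hf.dist_le_mul x hx z hz
  obtain ⟨x, hx, hfix, -⟩ := ContractingWith.exists_fixedPoint' (K := K) (f := T)
    (isClosed_Icc (a := (0 : ι → ℝ)) (b := 1)).isComplete hmaps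
    ⟨hK, fun x z ↦ hlip x.2 z.2⟩ hy (edist_ne_top _ _)
  refine ⟨x, hx, funext fun i ↦ ?_⟩
  have hi : max 0 (min 1 (y i - f x i)) = x i := by
    rw [← coe_projIcc (0 : ℝ) 1 zero_le_one]
    exact congrFun hfix i
  have hy0 : 0 ≤ y i := hy.1 i
  have hy1 : y i ≤ 1 := hy.2 i
  have h0i := h0 x hx i
  show x i + f x i = y i
  rcases le_total (y i - f x i) 0 with h | h
  · have hxi : x i = 0 := by
      rw [← hi]; exact max_eq_left ((min_le_right _ _).trans h)
    have := h0i (Or.inl hxi)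
    linarith
  · rcases le_total 1 (y i - f x i) with h' | h'
    · have hxi : x i = 1 := by
        rw [← hi, min_eq_left h']; exact max_eq_right zero_le_one
      have := h0i (Or.inr hxi)
      linarith
    · rw [min_eq_right h', max_eq_right h] at hi
      linarith

/-- A small `C¹` perturbation of the identity preserving each pair of opposite faces of the unit
cube has Jacobian determinant of integral one. -/
theorem eventually_setIntegral_det_one_add_smul_fderiv {ι : Type*} [Fintype ι]
    {g : (ι → ℝ) → ι → ℝ} (hg : ContDiff ℝ 1 g)
    (hmaps : ∀ x ∈ Icc (0 : ι → ℝ) 1, x + g x ∈ Icc (0 : ι → ℝ) 1)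
    (h0 : ∀ x ∈ Icc (0 : ι → ℝ) 1, ∀ i, x i = 0 ∨ x i = 1 → g x i = 0) :
    ∀ᶠ t : ℝ in 𝓝[>] 0, ∫ x in Icc (0 : ι → ℝ) 1, (1 + t • fderiv ℝ g x).det = 1 := by
  have hcg : Continuous (fderiv ℝ g) := hg.continuous_fderiv one_ne_zero
  have hdet : ∀ᶠ t : ℝ in 𝓝 0, ∀ x ∈ Icc (0 : ι → ℝ) 1, 0 < (1 + t • fderiv ℝ g x).det := by
    refine isCompact_Icc.eventually_forall_of_forall_eventually fun x _ ↦ ?_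
    have hc : Continuous fun z : ℝ × (ι → ℝ) ↦ (1 + z.1 • fderiv ℝ g z.2).det := by
      apply ContinuousLinearMap.continuous_det.comp
      fun_prop
    refine hc.continuousAt.eventually_const_lt ?_
    simp [ContinuousLinearMap.det]
  obtain ⟨C, hC⟩ := isCompact_Icc (a := (0 : ι → ℝ)) (b := 1) |>.exists_bound_of_continuousOn
    hcg.continuousOn
  have hC0 : 0 ≤ C := (norm_nonneg _).trans (hC 0 ⟨le_rfl, zero_le_one⟩)
  have hlip : LipschitzOnWith ⟨C, hC0⟩ g (Icc 0 1) :=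
    (convex_Icc _ _).lipschitzOnWith_of_nnnorm_fderiv_le
      (fun x _ ↦ hg.differentiable one_ne_zero x) hC
  have hsmall : ∀ᶠ t : ℝ in 𝓝 0, t * C < 1 := by
    have : Continuous fun t : ℝ ↦ t * C := by fun_prop
    exact this.continuousAt.eventually_lt_const (by simp)
  have hone : ∀ᶠ t : ℝ in 𝓝 0, t < 1 := eventually_lt_nhds zero_lt_one
  filter_upwards [self_mem_nhdsWithin, nhdsWithin_le_nhds hdet, nhdsWithin_le_nhds hsmall,
    nhdsWithin_le_nhds hone] with t ht htdet htC ht1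
  have ht0 : (0 : ℝ) ≤ t := le_of_lt ht
  have hK : (⟨t * C, mul_nonneg ht0 hC0⟩ : NNReal) < 1 := htC
  have htlip : LipschitzOnWith ⟨t * C, mul_nonneg ht0 hC0⟩ (fun x ↦ t • g x) (Icc 0 1) := by
    refine LipschitzOnWith.of_dist_le_mul fun x hx z hz ↦ ?_
    rw [dist_smul₀, Real.norm_of_nonneg ht0]
    calc t * dist (g x) (g z) ≤ t * (C * dist x z) := by
          gcongr; exact hlip.dist_le_mul x hx z hz
      _ = t * C * dist x z := by ring
  have hsurj : SurjOn (fun x ↦ x + t • g x) (Icc 0 1) (Icc 0 1) :=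
    surjOn_unitCube_of_lipschitzOnWith hK htlip fun x hx i hi ↦ by simp [h0 x hx i hi]
  have hmapsTo : MapsTo (fun x ↦ x + t • g x) (Icc (0 : ι → ℝ) 1) (Icc 0 1) := fun x hx ↦
    (convex_Icc _ _).add_smul_mem hx (hmaps x hx) ⟨ht0, ht1.le⟩
  have hinj : InjOn (fun x ↦ x + t • g x) (Icc (0 : ι → ℝ) 1) := by
    intro x hx z hz hxz
    have h1 : dist x z = dist (t • g x) (t • g z) := by
      have : x - z = -(t • g x - t • g z) := by
        have : x + t • g x = z + t • g z := hxz
        linear_combination this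
      rw [dist_eq_norm, dist_eq_norm, this, norm_neg]
    have h2 : dist (t • g x) (t • g z) ≤ t * C * dist x z := htlip.dist_le_mul x hx z hz
    have h3 : dist x z = 0 := by nlinarith [dist_nonneg (x := x) (y := z)]
    exact dist_eq_zero.1 h3
  have key := integral_image_eq_integral_abs_det_fderiv_smul volume
    (measurableSet_Icc (a := (0 : ι → ℝ)) (b := 1)) (f := fun x ↦ x + t • g x)
    (f' := fun x ↦ 1 + t • fderiv ℝ g x)
    (fun x _ ↦ ((hasFDerivAt_id x).add
      ((hg.differentiable one_ne_zero x).hasFDerivAt.const_smul t)).hasFDerivWithinAt)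
    hinj (fun _ ↦ (1 : ℝ))
  rw [hsurj.image_eq_of_mapsTo hmapsTo] at key
  have hvol : ∫ _ in Icc (0 : ι → ℝ) 1, (1 : ℝ) = 1 := by
    simp [Measure.real, Real.volume_Icc_pi]
  rw [hvol] at key
  rw [key]
  refine setIntegral_congr_fun measurableSet_Icc fun x hx ↦ ?_
  simp [abs_of_pos (htdet x hx)]

/-- A `C¹` map of the unit cube into itself preserving all faces has Jacobian determinant of
integral one. -/
theorem setIntegral_det_fderiv_eq_one {ι : Type*} [Fintype ι]
    {w : (ι → ℝ) → ι → ℝ} (hw : ContDiff ℝ 1 w)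
    (hmaps : ∀ x ∈ Icc (0 : ι → ℝ) 1, w x ∈ Icc (0 : ι → ℝ) 1)
    (h0 : ∀ x ∈ Icc (0 : ι → ℝ) 1, ∀ i, x i = 0 → w x i = 0)
    (h1 : ∀ x ∈ Icc (0 : ι → ℝ) 1, ∀ i, x i = 1 → w x i = 1) :
    ∫ x in Icc (0 : ι → ℝ) 1, (fderiv ℝ w x).det = 1 := by
  set g : (ι → ℝ) → ι → ℝ := fun x ↦ w x - x with hgdef
  have hg : ContDiff ℝ 1 g := hw.sub contDiff_id
  have hev := eventually_setIntegral_det_one_add_smul_fderiv hg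
    (fun x hx ↦ by simpa [hgdef] using hmaps x hx)
    (fun x hx i hi ↦ by
      rcases hi with hi | hi
      · simp [hgdef, hi, h0 x hx i hi]
      · simp [hgdef, hi, h1 x hx i hi])
  obtain ⟨ε, hε, hsub⟩ := mem_nhdsGT_iff_exists_Ioo_subset.1 hev
  have hε : 0 < ε := hε
  set v : ℕ → ℝ := fun j ↦ ε / (j + 2) with hv
  have hvinj : Function.Injective v := by
    intro a b hab
    have h : ε / ((a : ℝ) + 2) = ε / (b + 2) := hab
    rw [div_eq_div_iff (by positivity) (by positivity)] at h
    have := mul_left_cancel₀ hε.ne' h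
    have h' : (a : ℝ) = b := by linarith
    exact_mod_cast h'
  have hvmem : ∀ j, ∫ x in Icc (0 : ι → ℝ) 1, (1 + v j • fderiv ℝ g x).det = 1 := by
    intro j
    refine hsub ⟨by positivity, ?_⟩
    exact div_lt_self hε (by linarith [(Nat.cast_nonneg j : (0 : ℝ) ≤ j)])
  have hfd : ∀ x, fderiv ℝ w x = 1 + (1 : ℝ) • fderiv ℝ g x := by
    intro x
    have : fderiv ℝ g x = fderiv ℝ w x - ContinuousLinearMap.id ℝ (ι → ℝ) :=
      ((hw.differentiable one_ne_zero x).hasFDerivAt.sub (hasFDerivAt_id x)).fderiv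
    rw [this, one_smul]
    exact (add_sub_cancel _ _).symm
  have hcont : ∀ t : ℝ, Continuous fun x ↦ (1 + t • fderiv ℝ g x).det := by
    intro t
    have := hg.continuous_fderiv one_ne_zero
    apply ContinuousLinearMap.continuous_det.comp
    fun_prop
  simp_rw [hfd, ContinuousLinearMap.det_one_add_smul_eq_sum_basis _ v hvinj 1]
  rw [integral_finsetSum _ fun j _ ↦
    ((hcont (v j)).continuousOn.integrableOn_compact isCompact_Icc).mul_const _]
  simp_rw [integral_mul_const, hvmem, one_mul]
  rw [← Polynomial.eval_finsetSum, Lagrange.sum_basis hvinj.injOn (by simp), Polynomial.eval_one]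

/-- If a coordinate of a map into the unit cube attains one of its extreme values at `x`, then the
Jacobian determinant vanishes at `x`. -/
theorem det_fderiv_eq_zero_of_coord_extreme {ι : Type*} [Fintype ι]
    {w : (ι → ℝ) → ι → ℝ} (hw : Differentiable ℝ w) (hmem : ∀ x, w x ∈ Icc (0 : ι → ℝ) 1)
    {x : ι → ℝ} {i : ι} (hx : w x i = 0 ∨ w x i = 1) : (fderiv ℝ w x).det = 0 := by
  have hi : fderiv ℝ (fun y ↦ w y i) x = 0 := by
    rcases hx with hx | hx
    · refine IsLocalMin.fderiv_eq_zero (Eventually.of_forall fun y ↦ ?_)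
      simpa [hx] using (hmem y).1 i
    · refine IsLocalMax.fderiv_eq_zero (Eventually.of_forall fun y ↦ ?_)
      simpa [hx] using (hmem y).2 i
  have hrow : ∀ z, fderiv ℝ w x z i = 0 := by
    intro z
    have := (hasFDerivAt_pi'.1 (hw x).hasFDerivAt i).fderiv
    rw [hi] at this
    simpa using (DFunLike.congr_fun this z).symm
  classical
  rw [ContinuousLinearMap.det, ← LinearMap.det_toMatrix']
  refine Matrix.det_eq_zero_of_row_eq_zero i fun j ↦ ?_
  rw [LinearMap.toMatrix'_apply]
  exact hrow _

/-- **Poincaré–Miranda theorem** on the unit cube, with strict boundary conditions. -/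
theorem exists_eq_zero_of_continuous_unitCube {ι : Type*} [Fintype ι]
    {F : (ι → ℝ) → ι → ℝ} (hF : Continuous F)
    (h0 : ∀ x ∈ Icc (0 : ι → ℝ) 1, ∀ i, x i = 0 → F x i < 0)
    (h1 : ∀ x ∈ Icc (0 : ι → ℝ) 1, ∀ i, x i = 1 → 0 < F x i) :
    ∃ x ∈ Icc (0 : ι → ℝ) 1, F x = 0 := by
  by_contra! hne
  have hface : ∀ (i : ι) (c : ℝ), IsCompact {x ∈ Icc (0 : ι → ℝ) 1 | x i = c} := fun i c ↦
    isCompact_Icc.inter_right (isClosed_eq (continuous_apply i) continuous_const)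
  have hFi : ∀ i, Continuous fun x ↦ F x i := fun i ↦ (continuous_apply i).comp hF
  obtain ⟨a, ha, hFa⟩ : ∃ a > 0, ∀ x ∈ Icc (0 : ι → ℝ) 1, a ≤ ‖F x‖ :=
    isCompact_Icc.exists_forall_le' hF.norm.continuousOn fun x hx ↦ norm_pos_iff.2 (hne x hx)
  have hb : ∀ i, ∃ b > 0, ∀ x ∈ {x ∈ Icc (0 : ι → ℝ) 1 | x i = 0}, b ≤ -F x i := fun i ↦
    (hface i 0).exists_forall_le' (hFi i).neg.continuousOn fun x hx ↦ neg_pos.2 (h0 x hx.1 i hx.2)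
  have hc : ∀ i, ∃ c > 0, ∀ x ∈ {x ∈ Icc (0 : ι → ℝ) 1 | x i = 1}, c ≤ F x i := fun i ↦
    (hface i 1).exists_forall_le' (hFi i).continuousOn fun x hx ↦ h1 x hx.1 i hx.2
  choose b hb0 hb using hb
  choose c hc0 hc using hc
  obtain ⟨ε, hε, hεa, hεb, hεc⟩ : ∃ ε > 0, ε ≤ a ∧ (∀ i, ε ≤ b i) ∧ ∀ i, ε ≤ c i := by
    have : ∀ᶠ ε : ℝ in 𝓝[>] 0, ε ≤ a ∧ (∀ i, ε ≤ b i) ∧ ∀ i, ε ≤ c i := by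
      refine nhdsWithin_le_nhds ?_
      exact (eventually_le_nhds ha).and ((eventually_all.2 fun i ↦ eventually_le_nhds (hb0 i)).and
        (eventually_all.2 fun i ↦ eventually_le_nhds (hc0 i)))
    obtain ⟨ε, h, hε⟩ := (this.and self_mem_nhdsWithin).exists
    exact ⟨ε, hε, h⟩
  obtain ⟨u, hu, hclose, -⟩ := hF.exists_contDiff_approx 1 (ε := fun _ ↦ ε / 2)
    continuous_const fun _ ↦ half_pos hε
  have hui : ∀ x i, |u x i - F x i| < ε / 2 := fun x i ↦
    (dist_le_pi_dist (u x) (F x) i).trans_lt (hclose x)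
  set w : (ι → ℝ) → ι → ℝ := fun x i ↦ Real.smoothTransition (u x i / ε + 1 / 2) with hwdef
  have hw : ContDiff ℝ 1 w := contDiff_pi.2 fun i ↦
    (Real.smoothTransition.contDiff (n := 1)).comp
      (((contDiff_pi.1 hu i).div_const ε).add contDiff_const)
  have hmem : ∀ x, w x ∈ Icc (0 : ι → ℝ) 1 := fun x ↦
    ⟨fun i ↦ Real.smoothTransition.nonneg _, fun i ↦ Real.smoothTransition.le_one _⟩
  have hw0 : ∀ x i, u x i ≤ -(ε / 2) → w x i = 0 := by
    intro x i h
    refine Real.smoothTransition.zero_of_nonpos ?_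
    have : u x i / ε ≤ -(1 / 2) := by rw [div_le_iff₀ hε]; linarith
    linarith
  have hw1 : ∀ x i, ε / 2 ≤ u x i → w x i = 1 := by
    intro x i h
    refine Real.smoothTransition.one_of_one_le ?_
    have : 1 / 2 ≤ u x i / ε := by rw [le_div_iff₀ hε]; linarith
    linarith
  have hint := setIntegral_det_fderiv_eq_one hw (fun x _ ↦ hmem x)
    (fun x hx i hi ↦ hw0 x i (by
      linarith [hb i x ⟨hx, hi⟩, hεb i, (abs_lt.1 (hui x i)).2]))
    (fun x hx i hi ↦ hw1 x i (by
      linarith [hc i x ⟨hx, hi⟩, hεc i, (abs_lt.1 (hui x i)).1]))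
  rw [setIntegral_eq_zero_of_forall_eq_zero] at hint
  · exact zero_ne_one hint
  intro x hx
  obtain ⟨i, hi⟩ : ∃ i, ε ≤ |F x i| := by
    by_contra! h
    exact ((pi_norm_lt_iff hε).2 h).not_ge (hεa.trans (hFa x hx))
  refine det_fderiv_eq_zero_of_coord_extreme (hw.differentiable one_ne_zero) hmem (i := i) ?_
  have := abs_lt.1 (hui x i)
  rcases le_abs.1 hi with h | h
  · exact Or.inr (hw1 x i (by linarith))
  · exact Or.inl (hw0 x i (by linarith))

/-- Eigenvalue-matching lemma: given continuous strictly monotone functions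
`λᵢ : ℝ → ℝ` with `λᵢ 1 = lᵢ` and a box `[1-r, 1+r]^m`, there is `δ > 0` such that any
continuous map `G` whose components are uniformly `δ`-close to `(λ₁(x₁),…,λ_m(x_m))`
on the box attains the value `(l₁,…,l_m)` at some point of the box. -/
theorem exists_prescribed_values_of_uniformly_close
    (m : ℕ) (hm : 1 ≤ m) (lam : Fin m → ℝ → ℝ)
    (hcont : ∀ i, Continuous (lam i))
    (hmono : ∀ i, StrictMono (lam i) ∨ StrictAnti (lam i))
    (l : Fin m → ℝ) (hl : ∀ i, lam i 1 = l i)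
    (r : ℝ) (hr : 0 < r) :
    ∃ δ > 0, ∀ G : (Fin m → ℝ) → (Fin m → ℝ), Continuous G →
      (∀ x ∈ Set.Icc (fun _ : Fin m => 1 - r) (fun _ : Fin m => 1 + r),
        ∀ i, |G x i - lam i (x i)| < δ) →
      ∃ t ∈ Set.Icc (fun _ : Fin m => 1 - r) (fun _ : Fin m => 1 + r),
        ∀ i, G t i = l i := by
  have hsign : ∀ i, ∃ s : ℝ, |s| = 1 ∧ s * (lam i (1 - r) - l i) < 0 ∧
      0 < s * (lam i (1 + r) - l i) := by
    intro i
    rcases hmono i with h | h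
    · have h1 := h (show 1 - r < 1 by linarith)
      have h2 := h (show 1 < 1 + r by linarith)
      rw [hl i] at h1 h2
      exact ⟨1, by simp, by linarith, by linarith⟩
    · have h1 := h (show 1 - r < 1 by linarith)
      have h2 := h (show 1 < 1 + r by linarith)
      rw [hl i] at h1 h2
      exact ⟨-1, by simp, by linarith, by linarith⟩
  choose s hs hneg hpos using hsign
  obtain ⟨δ, hδ, hδneg, hδpos⟩ : ∃ δ > 0, (∀ i, δ ≤ -(s i * (lam i (1 - r) - l i))) ∧
      ∀ i, δ ≤ s i * (lam i (1 + r) - l i) := by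
    have : ∀ᶠ δ : ℝ in 𝓝[>] 0, (∀ i, δ ≤ -(s i * (lam i (1 - r) - l i))) ∧
        ∀ i, δ ≤ s i * (lam i (1 + r) - l i) := by
      refine nhdsWithin_le_nhds ?_
      exact (eventually_all.2 fun i ↦ eventually_le_nhds (neg_pos.2 (hneg i))).and
        (eventually_all.2 fun i ↦ eventually_le_nhds (hpos i))
    obtain ⟨δ, h, hδ⟩ := (this.and self_mem_nhdsWithin).exists
    exact ⟨δ, hδ, h⟩
  refine ⟨δ, hδ, fun G hG hclose ↦ ?_⟩
  set φ : (Fin m → ℝ) → Fin m → ℝ := fun x i ↦ 1 - r + 2 * r * x i with hφ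
  have hφmem : ∀ x ∈ Set.Icc (0 : Fin m → ℝ) 1,
      φ x ∈ Set.Icc (fun _ : Fin m => 1 - r) (fun _ : Fin m => 1 + r) := by
    intro x hx
    have hx0 : ∀ i, 0 ≤ x i := hx.1
    have hx1 : ∀ i, x i ≤ 1 := hx.2
    exact ⟨fun i ↦ by simp only [hφ]; nlinarith [hx0 i], fun i ↦ by
      simp only [hφ]; nlinarith [hx1 i]⟩
  have hbound : ∀ x ∈ Set.Icc (0 : Fin m → ℝ) 1, ∀ i,
      |s i * (G (φ x) i - lam i (φ x i))| < δ := by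
    intro x hx i
    rw [abs_mul, hs i, one_mul]
    exact hclose _ (hφmem x hx) i
  obtain ⟨x, hx, hzero⟩ := exists_eq_zero_of_continuous_unitCube
    (F := fun x i ↦ s i * (G (φ x) i - l i)) (by fun_prop)
    (fun x hx i hi ↦ by
      have h := (abs_lt.1 (hbound x hx i)).2
      have hv : φ x i = 1 - r := by simp [hφ, hi]
      rw [hv] at h
      linarith [hδneg i])
    (fun x hx i hi ↦ by
      have h := (abs_lt.1 (hbound x hx i)).1
      have hv : φ x i = 1 + r := by simp only [hφ, hi]; ring
      rw [hv] at h
      linarith [hδpos i])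
  refine ⟨φ x, hφmem x hx, fun i ↦ ?_⟩
  have hs0 : s i ≠ 0 := by
    intro h
    simpa [h] using hs i
  have h : s i * (G (φ x) i - l i) = 0 := congrFun hzero i
  exact sub_eq_zero.1 ((mul_eq_zero.1 h).resolve_left hs0)
end
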